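/- Let (μ_n) and (σ_n) be sequences of positive real numbers satisfying μ_n → ∞, σ_n (log σ_n)² = o(μ_n), and μ_n = o(σ_n³) as n → ∞. Let (X_n) be a sequence of random variables taking values in the nonnegative integers with all factorial moments finite, and suppose there exist constants c' > c > 0 such that, uniformly for all integers k in the range c μ_n/σ_n ≤ k ≤ c' μ_n/σ_n, one has E[(X_n)_k] ~ μ_n^k · exp((k²/2) · (σ_n² − μ_n)/μ_n²); that is, for every ε > 0 there is N such that for all n ≥ N and all integers k with c μ_n/σ_n ≤ k ≤ c' μ_n/σ_n, |E[(X_n)_k] · μ_n^{−k} · exp(−(k²/2)(σ_n² − μ_n)/μ_n²) − 1| ≤ ε. Then (X_n − μ_n)/σ_n converges in distribution to the standard normal distribution N(0,1). -/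

import Mathlib

open MeasureTheory Filter Asymptotics

noncomputable section

/-- The `k`-th factorial moment `E[(X)_k]` of a nonnegative-integer-valued random variable `X`
under the probability measure `P`, computed as `∑_j P(X = j) · (j)_k` where
`(j)_k = j (j-1) ⋯ (j-k+1)` is the falling factorial. -/
def factorialMoment {Ω : Type*} [MeasurableSpace Ω] (P : Measure Ω) (X : Ω → ℕ) (k : ℕ) : ℝ :=
  ∑' j : ℕ, (P {ω | X ω = j}).toReal * (j.descFactorial k : ℝ)

section

open Topology ProbabilityTheory

/-- The continuous function equal to `1` on `[-A, A]`, vanishing outside `[-A - 1, A + 1]` and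
affine in between. -/
def cutoff (A x : ℝ) : ℝ := max 0 (min 1 (A + 1 - |x|))

lemma continuous_cutoff (A : ℝ) : Continuous (cutoff A) := by
  unfold cutoff; fun_prop

lemma cutoff_nonneg (A x : ℝ) : 0 ≤ cutoff A x := le_max_left _ _

lemma cutoff_le_one (A x : ℝ) : cutoff A x ≤ 1 := by simp [cutoff]

lemma cutoff_eq_one {A x : ℝ} (h : |x| ≤ A) : cutoff A x = 1 := by
  have : 1 ≤ A + 1 - |x| := by linarith
  simp [cutoff, this]

lemma cutoff_eq_zero {A x : ℝ} (h : A + 1 < |x|) : cutoff A x = 0 := by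
  have : A + 1 - |x| ≤ 0 := by linarith
  simp [cutoff, this]

/-- A continuous function times a cutoff, as a bounded continuous function. -/
lemma exists_boundedContinuousFunction_cutoff_mul (A : ℝ) {f : ℝ → ℝ} (hf : Continuous f) :
    ∃ g : BoundedContinuousFunction ℝ ℝ, ∀ x, g x = cutoff A x * f x := by
  have hc : Continuous fun x => cutoff A x * f x := (continuous_cutoff A).mul hf
  have hs : HasCompactSupport fun x => cutoff A x * f x := by
    refine HasCompactSupport.intro (isCompact_closedBall (0 : ℝ) (A + 1)) fun x hx => ?_
    rw [cutoff_eq_zero (by simpa using hx), zero_mul]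
  obtain ⟨C, hC⟩ := hc.bounded_above_of_compact_support hs
  exact ⟨BoundedContinuousFunction.ofNormedAddCommGroup _ hc C hC, fun _ => rfl⟩

lemma abs_cutoff_mul_le (A : ℝ) {f : ℝ → ℝ} (hf : Continuous f) :
    ∃ C, 0 ≤ C ∧ ∀ x, |cutoff A x * f x| ≤ C := by
  obtain ⟨g, hg⟩ := exists_boundedContinuousFunction_cutoff_mul A hf
  exact ⟨‖g‖, norm_nonneg _, fun x => by simpa [hg] using g.norm_coe_le_norm x⟩

lemma tendsto_integral_cutoff_mul {ν : Measure ℝ} {f : ℝ → ℝ} (hf : Integrable f ν) :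
    Tendsto (fun A => ∫ x, cutoff A x * f x ∂ν) atTop (𝓝 (∫ x, f x ∂ν)) := by
  refine tendsto_integral_filter_of_dominated_convergence (fun x => |f x|)
    (.of_forall fun A => (continuous_cutoff A).aestronglyMeasurable.mul hf.1)
    (.of_forall fun A => .of_forall fun x => ?_) hf.abs (.of_forall fun x => ?_)
  · rw [Real.norm_eq_abs, abs_mul, abs_of_nonneg (cutoff_nonneg A x)]
    exact mul_le_of_le_one_left (abs_nonneg _) (cutoff_le_one A x)
  · refine tendsto_const_nhds.congr' ?_
    filter_upwards [eventually_ge_atTop |x|] with A hA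
    rw [cutoff_eq_one hA, one_mul]

/-- A nonnegative function whose truncated integrals are bounded is integrable. -/
lemma integrable_of_integral_cutoff_mul_le {ν : Measure ℝ} [IsFiniteMeasure ν] {f : ℝ → ℝ}
    (hf : Continuous f) (hf0 : ∀ x, 0 ≤ f x) {C : ℝ}
    (h : ∀ᶠ A in atTop, ∫ x, cutoff A x * f x ∂ν ≤ C) : Integrable f ν := by
  refine (aecover_closedBall (x := (0 : ℝ)) (r := fun A : ℝ => A)
    tendsto_id).integrable_of_integral_bounded_of_nonneg_ae C
    (fun A => (hf.continuousOn.integrableOn_compact (isCompact_closedBall _ _)))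
    (.of_forall hf0) ?_
  filter_upwards [h] with A hA
  refine le_trans ?_ hA
  rw [← integral_indicator measurableSet_closedBall]
  refine integral_mono_of_nonneg (.of_forall fun x => ?_) ?_ (.of_forall fun x => ?_)
  · exact Set.indicator_nonneg (fun y _ => hf0 y) x
  · obtain ⟨g, hg⟩ := exists_boundedContinuousFunction_cutoff_mul A hf
    exact (g.integrable ν).congr (.of_forall hg)
  · by_cases hx : x ∈ Metric.closedBall (0 : ℝ) A
    · have : |x| ≤ A := by simpa using hx
      simp [hx, cutoff_eq_one this]
    · simpa [hx] using mul_nonneg (cutoff_nonneg A x) (hf0 x)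

/-- Two finite measures on `ℝ` whose moment generating functions are finite and agree near `0`
coincide. -/
theorem MeasureTheory.Measure.ext_of_mgf_eventuallyEq {ρ τ : Measure ℝ} [IsFiniteMeasure ρ]
    [IsFiniteMeasure τ] (hρ : 0 ∈ interior (integrableExpSet id ρ))
    (hτ : 0 ∈ interior (integrableExpSet id τ)) (h : mgf id ρ =ᶠ[𝓝 0] mgf id τ) : ρ = τ := by
  refine Measure.ext_of_charFun (funext fun t => ?_)
  rw [← complexMGF_id_mul_I, ← complexMGF_id_mul_I]
  let S := interior (integrableExpSet id ρ) ∩ interior (integrableExpSet id τ)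
  have hS : Convex ℝ S :=
    convex_integrableExpSet.interior.inter convex_integrableExpSet.interior
  refine AnalyticOnNhd.eqOn_of_preconnected_of_frequently_eq (U := {z : ℂ | z.re ∈ S})
    (analyticOnNhd_complexMGF.mono fun z hz => hz.1)
    (analyticOnNhd_complexMGF.mono fun z hz => hz.2)
    (hS.linear_preimage Complex.reLm).isPreconnected (z₀ := 0) (by simp [S, hρ, hτ]) ?_
    (by simp [S, hρ, hτ])
  have h_real : ∃ᶠ x : ℝ in 𝓝[≠] 0, complexMGF id ρ x = complexMGF id τ x := by
    refine Eventually.frequently ?_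
    filter_upwards [nhdsWithin_le_nhds h] with x hx
    rw [complexMGF_ofReal, complexMGF_ofReal, hx]
  refine Tendsto.frequently (f := ((↑) : ℝ → ℂ)) ?_ h_real
  refine tendsto_nhdsWithin_iff.2 ⟨?_, ?_⟩
  · exact (Complex.continuous_ofReal.tendsto' 0 0 (by simp)).mono_left nhdsWithin_le_nhds
  · filter_upwards [self_mem_nhdsWithin] with x hx
    simpa using hx

/-- Convergence of truncated moment generating functions near `0` implies weak convergence. -/
theorem tendsto_of_tendsto_truncated_mgf {ν : ℕ → ProbabilityMeasure ℝ}
    {τ : ProbabilityMeasure ℝ} (hτ : 0 ∈ interior (integrableExpSet id (τ : Measure ℝ)))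
    (h : ∀ᶠ s in 𝓝 0, ∀ ε > 0, ∀ᶠ A in atTop, ∀ᶠ n in atTop,
      |∫ x, cutoff A x * Real.exp (s * x) ∂(ν n : Measure ℝ) - mgf id τ s| ≤ ε) :
    Tendsto ν atTop (𝓝 τ) := by
  have htight : IsTightMeasureSet (Set.range fun n => (ν n : Measure ℝ)) := by
    refine isTightMeasureSet_range_of_tendsto_limsup_measure_norm_gt ?_
    rw [ENNReal.tendsto_nhds_zero]
    intro ε hε
    obtain ⟨η, hη, hηε⟩ := ENNReal.lt_iff_exists_nnreal_btwn.1 hε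
    have h0 := (h.self_of_nhds) η (by simpa using hη)
    filter_upwards [(tendsto_atTop_add_const_right atTop (-1 : ℝ) tendsto_id).eventually h0]
      with A hA
    refine limsup_le_of_le (h := ?_)
    filter_upwards [hA] with n hn
    refine le_trans ?_ hηε.le
    rw [← ENNReal.ofReal_coe_nnreal, ← ofReal_measureReal]
    refine ENNReal.ofReal_le_ofReal ?_
    have hm : MeasurableSet {x : ℝ | A < ‖x‖} := by measurability
    have hint : Integrable (cutoff (A - 1)) (ν n : Measure ℝ) := by
      obtain ⟨g, hg⟩ := exists_boundedContinuousFunction_cutoff_mul (A - 1) continuous_one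
      exact (g.integrable _).congr (.of_forall fun x => by simp [hg])
    have hle : ∫ x, cutoff (A - 1) x ∂(ν n : Measure ℝ) ≤
        ∫ x, 1 - {x : ℝ | A < ‖x‖}.indicator 1 x ∂(ν n : Measure ℝ) := by
      refine integral_mono hint ((integrable_const _).sub
        ((integrable_const (1 : ℝ)).indicator hm)) fun x => ?_
      by_cases hx : A < |x|
      · simp [hx, cutoff_eq_zero (A := A - 1) (x := x) (by linarith)]
      · simpa [hx] using cutoff_le_one _ _
    rw [integral_sub (f := fun _ => (1 : ℝ)) (g := {x : ℝ | A < ‖x‖}.indicator 1)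
      (integrable_const _) ((integrable_const (1 : ℝ)).indicator hm),
      integral_indicator_one hm] at hle
    simp only [integral_const, probReal_univ, one_smul] at hle
    simp [mgf, ← sub_eq_add_neg] at hn
    rw [abs_le] at hn
    linarith [hn.1]
  rw [tendsto_iff_ultrafilter]
  intro U hU
  have hcomp : IsCompact (closure (Set.range ν)) := by
    refine isCompact_closure_of_isTightMeasureSet ?_
    convert htight using 1
    ext; simp
  obtain ⟨ρ, -, hρ : Tendsto ν U (𝓝 ρ)⟩ := hcomp.ultrafilter_le_nhds (U.map ν)
    (.trans (by simp) (Filter.monotone_principal subset_closure))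
  have key : ∀ᶠ s in 𝓝 0, Integrable (fun x => Real.exp (s * x)) (ρ : Measure ℝ) ∧
      mgf id ρ s = mgf id τ s := by
    filter_upwards [h] with s hs
    have hs' : ∀ ε > 0, ∀ᶠ A in atTop,
        |∫ x, cutoff A x * Real.exp (s * x) ∂(ρ : Measure ℝ) - mgf id τ s| ≤ ε := by
      intro ε hε
      filter_upwards [hs ε hε] with A hA
      obtain ⟨g, hg⟩ := exists_boundedContinuousFunction_cutoff_mul A
        (f := fun x => Real.exp (s * x)) (by fun_prop)
      have hlim := ProbabilityMeasure.tendsto_iff_forall_integral_tendsto.1 hρ g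
      simp only [hg] at hlim
      exact le_of_tendsto (hlim.sub_const _).abs (hU hA)
    have hint : Integrable (fun x => Real.exp (s * x)) (ρ : Measure ℝ) := by
      refine integrable_of_integral_cutoff_mul_le (C := mgf id τ s + 1) (by fun_prop)
        (fun x => (Real.exp_pos _).le) ?_
      filter_upwards [hs' 1 one_pos] with A hA
      linarith [(abs_le.1 hA).2]
    refine ⟨hint, tendsto_nhds_unique (tendsto_integral_cutoff_mul hint) ?_⟩
    rw [Metric.tendsto_nhds]
    intro ε hε
    filter_upwards [hs' (ε / 2) (by positivity)] with A hA
    exact hA.trans_lt (half_lt_self hε)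
  have hρτ : (ρ : Measure ℝ) = τ := Measure.ext_of_mgf_eventuallyEq
    (mem_interior_iff_mem_nhds.2 (key.mono fun s hs => hs.1)) hτ (key.mono fun s hs => hs.2)
  rwa [← Subtype.ext hρτ]

section Tilting

variable {Ω : Type*} [MeasurableSpace Ω] {P : Measure Ω}

/-- The law of `Z` under the probability measure with density proportional to `G`. -/
lemma exists_law_withDensity {Z G : Ω → ℝ} (hZ : Measurable Z) (hG : Measurable G)
    (hG0 : ∀ ω, 0 ≤ G ω) (hGi : Integrable G P) (hpos : ∫ ω, G ω ∂P ≠ 0) :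
    ∃ ν : ProbabilityMeasure ℝ, ∀ g : ℝ → ℝ, Continuous g →
      ∫ x, g x ∂(ν : Measure ℝ) = (∫ ω, g (Z ω) * G ω ∂P) / ∫ ω, G ω ∂P := by
  set I := ∫ ω, G ω ∂P with hI
  have hI0 : 0 ≤ I := integral_nonneg hG0
  let d : Ω → NNReal := fun ω => (G ω / I).toNNReal
  have hd : Measurable d := (hG.div_const I).real_toNNReal
  have hprob : IsProbabilityMeasure (P.withDensity fun ω => (d ω : ENNReal)) := by
    constructor
    rw [withDensity_apply _ MeasurableSet.univ, Measure.restrict_univ]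
    have : ∫⁻ ω, (d ω : ENNReal) ∂P = ENNReal.ofReal (∫ ω, G ω / I ∂P) :=
      (ofReal_integral_eq_lintegral_ofReal (hGi.div_const I)
        (.of_forall fun ω => div_nonneg (hG0 ω) hI0)).symm
    rw [this, integral_div, ← hI, div_self hpos, ENNReal.ofReal_one]
  refine ⟨⟨(P.withDensity fun ω => (d ω : ENNReal)).map Z,
    Measure.isProbabilityMeasure_map hZ.aemeasurable⟩, fun g hg => ?_⟩
  rw [ProbabilityMeasure.coe_mk, integral_map hZ.aemeasurable hg.aestronglyMeasurable,
    integral_withDensity_eq_integral_smul hd, ← integral_div]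
  refine integral_congr_ae (.of_forall fun ω => ?_)
  simp only [d, NNReal.smul_def, Real.coe_toNNReal _ (div_nonneg (hG0 ω) hI0), smul_eq_mul]
  ring

lemma integrable_cutoff_mul_comp_mul {Y G : Ω → ℝ} (hY : Measurable Y) (hG : Integrable G P)
    (A : ℝ) {f : ℝ → ℝ} (hf : Continuous f) :
    Integrable (fun ω => cutoff A (Y ω) * f (Y ω) * G ω) P := by
  obtain ⟨C, -, hC⟩ := abs_cutoff_mul_le A hf
  exact hG.bdd_mul (((continuous_cutoff A).mul hf).measurable.comp hY).aestronglyMeasurable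
    (.of_forall fun ω => hC _)

variable [IsProbabilityMeasure P] {Z : ℕ → Ω → ℝ}

lemma integrable_cutoff_mul_comp {Y : Ω → ℝ} (hY : Measurable Y) (A : ℝ) {f : ℝ → ℝ}
    (hf : Continuous f) : Integrable (fun ω => cutoff A (Y ω) * f (Y ω)) P := by
  obtain ⟨C, -, hC⟩ := abs_cutoff_mul_le A hf
  exact .of_bound (((continuous_cutoff A).mul hf).measurable.comp hY).aestronglyMeasurable C
    (.of_forall fun ω => hC _)

/-- On compact sets of values of `Z`, a weight that is locally uniformly close to `exp (t * Z)`
may be replaced by it. -/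
lemma tendsto_integral_cutoff_mul_sub (hZ : ∀ n, Measurable (Z n)) {G : ℕ → Ω → ℝ}
    (hG : ∀ n, Integrable (G n) P) {t : ℝ}
    (hloc : ∀ A : ℝ, ∀ ε > 0, ∀ᶠ n in atTop, ∀ ω, |Z n ω| ≤ A →
      |G n ω * Real.exp (-(t * Z n ω)) - 1| ≤ ε)
    (A : ℝ) {f : ℝ → ℝ} (hf : Continuous f) :
    Tendsto (fun n => ∫ ω, cutoff A (Z n ω) * f (Z n ω) * G n ω ∂P -
      ∫ ω, cutoff A (Z n ω) * (f (Z n ω) * Real.exp (t * Z n ω)) ∂P) atTop (𝓝 0) := by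
  have hfe : Continuous fun x => f x * Real.exp (t * x) := by fun_prop
  obtain ⟨C, hC0, hC⟩ := abs_cutoff_mul_le A hfe
  rw [Metric.tendsto_nhds]
  intro ε hε
  have hη : 0 < ε / (C + 1) := by positivity
  filter_upwards [hloc (A + 1) _ hη] with n hn
  rw [← integral_sub (integrable_cutoff_mul_comp_mul (hZ n) (hG n) A hf)
    (integrable_cutoff_mul_comp (hZ n) A hfe), dist_zero_right]
  have hb : ∀ ω, ‖cutoff A (Z n ω) * f (Z n ω) * G n ω -
      cutoff A (Z n ω) * (f (Z n ω) * Real.exp (t * Z n ω))‖ ≤ C * (ε / (C + 1)) := by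
    intro ω
    by_cases hω : |Z n ω| ≤ A + 1
    · have : cutoff A (Z n ω) * f (Z n ω) * G n ω -
          cutoff A (Z n ω) * (f (Z n ω) * Real.exp (t * Z n ω)) =
          cutoff A (Z n ω) * (f (Z n ω) * Real.exp (t * Z n ω)) *
            (G n ω * Real.exp (-(t * Z n ω)) - 1) := by
        rw [Real.exp_neg]
        field_simp
      rw [this, norm_mul]
      exact mul_le_mul (hC _) (hn ω hω) (norm_nonneg _) hC0
    · simp only [cutoff_eq_zero (not_le.1 hω), zero_mul, sub_zero, norm_zero]
      positivity
  calc _ ≤ C * (ε / (C + 1)) * P.real Set.univ := norm_integral_le_of_norm_le_const (.of_forall hb)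
    _ < ε := by
      rw [probReal_univ, mul_one, mul_div_assoc', div_lt_iff₀ (by positivity)]
      nlinarith

lemma abs_integral_sub_integral_cutoff_mul_le {Y : Ω → ℝ} (hY : Measurable Y)
    (φ : BoundedContinuousFunction ℝ ℝ) (A : ℝ) :
    |∫ ω, φ (Y ω) ∂P - ∫ ω, cutoff A (Y ω) * φ (Y ω) ∂P| ≤
      ‖φ‖ * (1 - ∫ ω, cutoff A (Y ω) * 1 ∂P) := by
  have hφ : Integrable (fun ω => φ (Y ω)) P :=
    .of_bound (φ.continuous.measurable.comp hY).aestronglyMeasurable ‖φ‖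
      (.of_forall fun ω => φ.norm_coe_le_norm _)
  have h1 : Integrable (fun ω => cutoff A (Y ω) * 1) P :=
    integrable_cutoff_mul_comp hY A continuous_one
  have h2 : 1 - ∫ ω, cutoff A (Y ω) * 1 ∂P = ∫ ω, (1 - cutoff A (Y ω) * 1) ∂P := by
    rw [integral_sub (integrable_const _) h1]; simp
  rw [← integral_sub hφ (integrable_cutoff_mul_comp hY A φ.continuous), h2, ← integral_const_mul]
  refine (abs_integral_le_integral_abs).trans (integral_mono
    (hφ.sub (integrable_cutoff_mul_comp hY A φ.continuous)).abs
    (((integrable_const _).sub h1).const_mul _) fun ω => ?_)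
  have : φ (Y ω) - cutoff A (Y ω) * φ (Y ω) = φ (Y ω) * (1 - cutoff A (Y ω) * 1) := by ring
  simp only [this, abs_mul]
  rw [abs_of_nonneg (a := 1 - cutoff A (Y ω) * 1) (by linarith [cutoff_le_one A (Y ω)])]
  exact mul_le_mul_of_nonneg_right (φ.norm_coe_le_norm _) (by linarith [cutoff_le_one A (Y ω)])

/-- Vague convergence of the laws of `Z n` to a probability measure implies weak convergence. -/
lemma tendsto_integral_of_tendsto_integral_cutoff_mul (hZ : ∀ n, Measurable (Z n))
    {γ : Measure ℝ} [IsProbabilityMeasure γ]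
    (h : ∀ (A : ℝ) (f : ℝ → ℝ), Continuous f →
      Tendsto (fun n => ∫ ω, cutoff A (Z n ω) * f (Z n ω) ∂P) atTop
        (𝓝 (∫ x, cutoff A x * f x ∂γ)))
    (φ : BoundedContinuousFunction ℝ ℝ) :
    Tendsto (fun n => ∫ ω, φ (Z n ω) ∂P) atTop (𝓝 (∫ x, φ x ∂γ)) := by
  rw [Metric.tendsto_nhds]
  intro ε hε
  have hγ1 : Tendsto (fun A => ‖φ‖ * (1 - ∫ x, cutoff A x * 1 ∂γ)) atTop (𝓝 0) := by
    simpa using ((tendsto_integral_cutoff_mul (ν := γ) (integrable_const 1)).const_sub 1).const_mul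
      ‖φ‖
  obtain ⟨A, hA⟩ := (hγ1.eventually (gt_mem_nhds (show 0 < ε / 4 by positivity))).exists
  have h1 := (((h A (fun _ => 1) continuous_const).const_sub 1).const_mul ‖φ‖).eventually
    (gt_mem_nhds hA)
  filter_upwards [h1, (h A φ φ.continuous).eventually
    (Metric.ball_mem_nhds _ (show 0 < ε / 4 by positivity))] with n hn1 hn2
  have e1 := abs_integral_sub_integral_cutoff_mul_le (P := P) (hZ n) φ A
  have e2 := abs_integral_sub_integral_cutoff_mul_le (P := γ) measurable_id φ A
  rw [Real.dist_eq, abs_lt] at hn2 ⊢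
  simp only [id] at e2
  rw [abs_le] at e1 e2
  constructor <;> linarith [e1.1, e1.2, e2.1, e2.2, hn2.1, hn2.2]

/-- Let `F t n` be nonnegative weights, comparable to `exp (t * Z n)` where `Z n` is bounded and
with negligible contribution from large values of `Z n`. If the expectations of `F t n` converge
to the moment generating function of `γ` for `t` in an interval, not necessarily containing `0`,
then `Z n` converges in distribution to `γ`. -/
theorem tendsto_integral_of_tendsto_weights (hZ : ∀ n, Measurable (Z n)) {F : ℝ → ℕ → Ω → ℝ}
    (hFm : ∀ t n, Measurable (F t n)) (hF0 : ∀ t n ω, 0 ≤ F t n ω)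
    (hFi : ∀ t n, Integrable (F t n) P) {γ : Measure ℝ} [IsProbabilityMeasure γ] {a b : ℝ}
    (hab : a < b) (hγ : ∀ t ∈ Set.Ioo a b, Integrable (fun x => Real.exp (t * x)) γ)
    (hF : ∀ t ∈ Set.Ioo a b, Tendsto (fun n => ∫ ω, F t n ω ∂P) atTop (𝓝 (mgf id γ t)))
    (hloc : ∀ t ∈ Set.Ioo a b, ∀ A : ℝ, ∀ ε > 0, ∀ᶠ n in atTop, ∀ ω, |Z n ω| ≤ A →
      |F t n ω * Real.exp (-(t * Z n ω)) - 1| ≤ ε)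
    (htail : ∀ r ∈ Set.Ioo a b, ∀ u ∈ Set.Ioo a b, ∀ t ∈ Set.Ioo r u, ∀ ε > 0,
      ∀ᶠ A : ℝ in atTop, ∀ᶠ n in atTop, ∀ ω, A < |Z n ω| →
        F t n ω ≤ ε * (F r n ω + F u n ω))
    (φ : BoundedContinuousFunction ℝ ℝ) :
    Tendsto (fun n => ∫ ω, φ (Z n ω) ∂P) atTop (𝓝 (∫ x, φ x ∂γ)) := by
  -- the truncated moment generating functions of `Z n` converge on `(a, b)`
  have htrunc : ∀ t ∈ Set.Ioo a b, ∀ ε > 0, ∀ᶠ A in atTop, ∀ᶠ n in atTop,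
      |∫ ω, cutoff A (Z n ω) * Real.exp (t * Z n ω) ∂P - mgf id γ t| ≤ ε := by
    intro t ht ε hε
    obtain ⟨r, hr1, hr2⟩ := exists_between ht.1
    obtain ⟨u, hu1, hu2⟩ := exists_between ht.2
    have hr : r ∈ Set.Ioo a b := ⟨hr1, hr2.trans ht.2⟩
    have hu : u ∈ Set.Ioo a b := ⟨ht.1.trans hu1, hu2⟩
    set K := mgf id γ r + mgf id γ u + 1 with hK
    have hK0 : 0 < K := by
      have := mgf_nonneg (X := id) (μ := γ) (t := r)
      have := mgf_nonneg (X := id) (μ := γ) (t := u)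
      positivity
    have hη : 0 < ε / 3 / K := by positivity
    filter_upwards [htail r hr u hu t ⟨hr2, hu1⟩ _ hη] with A hA
    have h1 := tendsto_integral_cutoff_mul_sub hZ (hFi t) (hloc t ht) A continuous_one
    have h2 := ((hF r hr).add (hF u hu)).eventually (gt_mem_nhds (lt_add_one _))
    filter_upwards [hA, h1.eventually (Metric.closedBall_mem_nhds 0 (ε := ε / 3) (by positivity)),
      (hF t ht).eventually (Metric.closedBall_mem_nhds _ (ε := ε / 3) (by positivity)), h2]
      with n hA h1 h3 h2
    have hci := integrable_cutoff_mul_comp_mul (P := P) (hZ n) (hFi t n) A continuous_one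
    have h4 : |∫ ω, F t n ω ∂P - ∫ ω, cutoff A (Z n ω) * (1 : ℝ → ℝ) (Z n ω) * F t n ω ∂P| ≤
        ε / 3 := by
      rw [← integral_sub (hFi t n) hci]
      have : ∀ ω, |F t n ω - cutoff A (Z n ω) * (1 : ℝ → ℝ) (Z n ω) * F t n ω| ≤
          ε / 3 / K * (F r n ω + F u n ω) := by
        intro ω
        have e0 := hF0 t n ω
        have er := hF0 r n ω
        have eu := hF0 u n ω
        have : F t n ω - cutoff A (Z n ω) * (1 : ℝ → ℝ) (Z n ω) * F t n ω =
          (1 - cutoff A (Z n ω)) * F t n ω := by simp; ring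
        rw [this]
        by_cases hω : |Z n ω| ≤ A
        · rw [cutoff_eq_one hω, sub_self, zero_mul, abs_zero]
          positivity
        · rw [abs_of_nonneg (mul_nonneg (by linarith [cutoff_le_one A (Z n ω)]) e0)]
          refine le_trans ?_ (hA ω (not_le.1 hω))
          exact mul_le_of_le_one_left e0 (by linarith [cutoff_nonneg A (Z n ω)])
      calc _ ≤ ∫ ω, |F t n ω - cutoff A (Z n ω) * (1 : ℝ → ℝ) (Z n ω) * F t n ω| ∂P :=
            abs_integral_le_integral_abs
        _ ≤ ∫ ω, ε / 3 / K * (F r n ω + F u n ω) ∂P :=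
            integral_mono ((hFi t n).sub hci).abs
              (((hFi r n).add (hFi u n)).const_mul _) this
        _ = ε / 3 / K * (∫ ω, F r n ω ∂P + ∫ ω, F u n ω ∂P) := by
            rw [integral_const_mul, integral_add (hFi r n) (hFi u n)]
        _ ≤ ε / 3 / K * K := by gcongr
        _ = ε / 3 := by field_simp
    simp only [Pi.one_apply, mul_one, one_mul] at h1 h4
    rw [Real.dist_eq, abs_le] at h1 h3
    rw [abs_le] at h4 ⊢
    constructor <;> linarith [h1.1, h1.2, h3.1, h3.2, h4.1, h4.2]
  obtain ⟨t₀, ht₀⟩ := exists_between hab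
  have ht₀i : Integrable (fun x => Real.exp (t₀ * x)) γ := hγ t₀ ht₀
  have hM : 0 < mgf id γ t₀ := mgf_pos ht₀i
  have hlaw : ∀ n, ∃ ν : ProbabilityMeasure ℝ, ∫ ω, F t₀ n ω ∂P ≠ 0 → ∀ g : ℝ → ℝ, Continuous g →
      ∫ x, g x ∂(ν : Measure ℝ) =
        (∫ ω, g (Z n ω) * F t₀ n ω ∂P) / ∫ ω, F t₀ n ω ∂P := by
    intro n
    by_cases h : ∫ ω, F t₀ n ω ∂P = 0
    · exact ⟨⟨γ, inferInstance⟩, fun h' => (h' h).elim⟩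
    · obtain ⟨ν, hν⟩ := exists_law_withDensity (hZ n) (hFm t₀ n) (hF0 t₀ n) (hFi t₀ n) h
      exact ⟨ν, fun _ => hν⟩
  choose ν hν using hlaw
  have hne : ∀ᶠ n in atTop, ∫ ω, F t₀ n ω ∂P ≠ 0 := (hF t₀ ht₀).eventually_ne hM.ne'
  let τ : ProbabilityMeasure ℝ := ⟨γ.tilted (t₀ * ·), isProbabilityMeasure_tilted ht₀i⟩
  have hτint : ∀ g : ℝ → ℝ,
      ∫ x, g x ∂(τ : Measure ℝ) = (∫ x, Real.exp (t₀ * x) * g x ∂γ) / mgf id γ t₀ := by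
    intro g
    rw [ProbabilityMeasure.coe_mk, integral_tilted, ← integral_div]
    simp only [mgf, id, smul_eq_mul]
    exact integral_congr_ae (.of_forall fun x => by ring)
  have hs : ∀ᶠ s : ℝ in 𝓝 0, t₀ + s ∈ Set.Ioo a b :=
    (continuous_const_add t₀).continuousAt.eventually_mem
      (by simpa using Ioo_mem_nhds ht₀.1 ht₀.2)
  have hντ : Tendsto ν atTop (𝓝 τ) := by
    refine tendsto_of_tendsto_truncated_mgf (mem_interior_iff_mem_nhds.2 ?_) ?_
    · filter_upwards [hs] with s hs
      change Integrable (fun x => Real.exp (s * id x)) (γ.tilted (t₀ * ·))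
      rw [integrable_tilted_iff ht₀i]
      refine (hγ _ hs).congr (.of_forall fun x => ?_)
      simp [add_mul, Real.exp_add]
    · filter_upwards [hs] with s hs ε hε
      have hmgf : mgf id τ s = mgf id γ (t₀ + s) / mgf id γ t₀ := by
        rw [mgf, hτint]
        congr 1
        simp [mgf, add_mul, Real.exp_add]
      filter_upwards [htrunc _ hs (ε * mgf id γ t₀ / 4) (by positivity)] with A hA
      have h1 := tendsto_integral_cutoff_mul_sub hZ (hFi t₀) (hloc t₀ ht₀) A
        (f := fun x => Real.exp (s * x)) (by fun_prop)
      have h2 := h1.sub ((hF t₀ ht₀).const_mul (mgf id γ (t₀ + s) / mgf id γ t₀))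
      rw [div_mul_cancel₀ _ hM.ne'] at h2
      filter_upwards [hA, h2.eventually (Metric.closedBall_mem_nhds _
        (show 0 < ε * mgf id γ t₀ / 4 by positivity)),
        (hF t₀ ht₀).eventually (lt_mem_nhds (half_lt_self hM))] with n hA h2 h3
      have hI : 0 < ∫ ω, F t₀ n ω ∂P := by linarith
      have he : Continuous fun x => cutoff A x * Real.exp (s * x) :=
        (continuous_cutoff A).mul (by fun_prop)
      rw [hν n hI.ne' _ he, hmgf]
      have hexp : ∀ ω, Real.exp (s * Z n ω) * Real.exp (t₀ * Z n ω) =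
          Real.exp ((t₀ + s) * Z n ω) := fun ω => by rw [← Real.exp_add]; congr 1; ring
      simp only [hexp, Real.dist_eq] at h2
      rw [div_sub' hI.ne', abs_div, abs_of_pos hI, div_le_iff₀ hI]
      have h4 : ε * (mgf id γ t₀ / 2) ≤ ε * ∫ ω, F t₀ n ω ∂P := by gcongr
      rw [abs_le] at h2 hA ⊢
      constructor <;> linarith [h2.1, h2.2, hA.1, hA.2]
  refine tendsto_integral_of_tendsto_integral_cutoff_mul hZ (fun A f hf => ?_) φ
  have hfe : Continuous fun x => f x * Real.exp (-(t₀ * x)) := by fun_prop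
  obtain ⟨g, hg⟩ := exists_boundedContinuousFunction_cutoff_mul A hfe
  have h1 := ((ProbabilityMeasure.tendsto_iff_forall_integral_tendsto.1 hντ g).mul (hF t₀ ht₀))
  have h2 := tendsto_integral_cutoff_mul_sub hZ (hFi t₀) (hloc t₀ ht₀) A hfe
  have h3 := h1.sub h2
  rw [hτint, div_mul_cancel₀ _ hM.ne', sub_zero] at h3
  have h4 : ∫ x, Real.exp (t₀ * x) * g x ∂γ = ∫ x, cutoff A x * f x ∂γ := by
    refine integral_congr_ae (.of_forall fun x => ?_)
    simp only [hg, Real.exp_neg]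
    field_simp
  rw [h4] at h3
  refine h3.congr' ?_
  filter_upwards [hne] with n hn
  rw [hν n hn g g.continuous, div_mul_cancel₀ _ hn]
  simp only [hg, sub_sub_cancel]
  refine integral_congr_ae (.of_forall fun ω => ?_)
  simp only [Real.exp_neg]
  field_simp

end Tilting

section FallingFactorialWeights

/-- The falling factorial `(x)_k` divided by `m ^ k * exp (-k² / (2m))`. -/
def normFF (m : ℝ) (k x : ℕ) : ℝ :=
  (x.descFactorial k : ℝ) / (m ^ k * Real.exp (-((k : ℝ) ^ 2 / (2 * m))))

lemma normFF_nonneg {m : ℝ} (hm : 0 < m) (k x : ℕ) : 0 ≤ normFF m k x := by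
  unfold normFF; positivity

lemma normFF_mul_le {m : ℝ} (hm : 0 < m) {k l x y : ℕ} (hkl : k ≤ l) (hxy : x ≤ y) :
    normFF m l x * normFF m k y ≤ normFF m l y * normFF m k x := by
  have key : x.descFactorial l * y.descFactorial k ≤ y.descFactorial l * x.descFactorial k := by
    rw [← Nat.descFactorial_mul_descFactorial (n := x) hkl,
      ← Nat.descFactorial_mul_descFactorial (n := y) hkl]
    have h := Nat.descFactorial_le (l - k) (Nat.sub_le_sub_right hxy k)
    calc _ = (x - k).descFactorial (l - k) * (x.descFactorial k * y.descFactorial k) := by ring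
      _ ≤ (y - k).descFactorial (l - k) * (x.descFactorial k * y.descFactorial k) := by gcongr
      _ = _ := by ring
  have key' : (x.descFactorial l : ℝ) * y.descFactorial k ≤
      y.descFactorial l * x.descFactorial k := by exact_mod_cast key
  unfold normFF
  rw [div_mul_div_comm, div_mul_div_comm]
  gcongr

lemma abs_log_one_add_sub_le {u : ℝ} (hu : |u| ≤ 1 / 2) : |Real.log (1 + u) - u| ≤ 2 * u ^ 2 := by
  have h := Real.abs_log_sub_add_sum_range_le (x := -u) (by rw [abs_neg]; linarith) 1
  simp only [Finset.sum_range_one, abs_neg] at h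
  norm_num at h
  rw [add_comm, ← sub_eq_add_neg] at h
  refine h.trans ?_
  rw [div_le_iff₀ (by linarith)]
  nlinarith [sq_nonneg u]

lemma abs_log_normFF_sub_le {m D : ℝ} (hm : 0 < m) {k x : ℕ} (hx : |(x : ℝ) - m| ≤ D)
    (hD : D + k ≤ m / 2) :
    0 < normFF m k x ∧
      |Real.log (normFF m k x) - k * (((x : ℝ) - m) / m)|
        ≤ k * (2 * ((D + k) / m) ^ 2) + k / (2 * m) := by
  have hx' := abs_le.1 hx
  have hkx : k ≤ x := by
    have : (k : ℝ) ≤ x := by linarith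
    exact_mod_cast this
  let u : ℕ → ℝ := fun i => ((x : ℝ) - m - i) / m
  have hu : ∀ i ∈ Finset.range k, |u i| ≤ (D + k) / m := by
    intro i hi
    have hi' : (i : ℝ) ≤ k := by exact_mod_cast (Finset.mem_range.1 hi).le
    have hi0 : (0 : ℝ) ≤ i := Nat.cast_nonneg i
    simp only [u, abs_div, abs_of_pos hm]
    gcongr
    rw [abs_le]; constructor <;> linarith
  have hhalf : (D + k) / m ≤ 1 / 2 := by rw [div_le_iff₀ hm]; linarith
  have hpos : ∀ i ∈ Finset.range k, 0 < 1 + u i := fun i hi => by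
    have := (abs_le.1 ((hu i hi).trans hhalf)).1
    linarith
  have hprod : (x.descFactorial k : ℝ) / m ^ k = ∏ i ∈ Finset.range k, (1 + u i) := by
    have hmk : m ^ k = ∏ _i ∈ Finset.range k, m := by simp
    rw [Nat.descFactorial_eq_prod_range, Nat.cast_prod, hmk, ← Finset.prod_div_distrib]
    refine Finset.prod_congr rfl fun i hi => ?_
    rw [Nat.cast_sub ((Finset.mem_range.1 hi).le.trans hkx)]
    simp only [u]
    field_simp
    ring
  have heq : normFF m k x =
      (∏ i ∈ Finset.range k, (1 + u i)) * Real.exp ((k : ℝ) ^ 2 / (2 * m)) := by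
    rw [← hprod, normFF, Real.exp_neg]
    field_simp
  have hP : 0 < ∏ i ∈ Finset.range k, (1 + u i) := Finset.prod_pos hpos
  refine ⟨by rw [heq]; positivity, ?_⟩
  have hsum : ∑ i ∈ Finset.range k, u i = k * (((x : ℝ) - m) / m) - k * (k - 1) / (2 * m) := by
    have hg : ∀ j : ℕ, ∑ i ∈ Finset.range j, u i
        = j * (((x : ℝ) - m) / m) - j * (j - 1) / (2 * m) := by
      intro j
      induction j with
      | zero => simp
      | succ j ih =>
        rw [Finset.sum_range_succ, ih]
        simp only [u]
        push_cast
        field_simp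
        ring
    exact hg k
  have hlog : Real.log (normFF m k x) - k * (((x : ℝ) - m) / m)
      = ∑ i ∈ Finset.range k, (Real.log (1 + u i) - u i) + k / (2 * m) := by
    rw [heq, Real.log_mul hP.ne' (Real.exp_pos _).ne', Real.log_exp,
      Real.log_prod (fun i hi => (hpos i hi).ne'), Finset.sum_sub_distrib, hsum]
    field_simp
    ring
  rw [hlog]
  refine (abs_add_le _ _).trans (add_le_add ?_ (abs_of_nonneg (by positivity)).le)
  refine (Finset.abs_sum_le_sum_abs _ _).trans ?_
  refine (Finset.sum_le_card_nsmul _ _ (2 * ((D + k) / m) ^ 2) fun i hi => ?_).trans ?_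
  · refine (abs_log_one_add_sub_le ((hu i hi).trans hhalf)).trans ?_
    rw [← sq_abs (u i)]
    gcongr
    exact hu i hi
  · simp

variable {μ σ : ℕ → ℝ}

lemma tendsto_floor_mul_div (hμpos : ∀ n, 0 < μ n) (hσpos : ∀ n, 0 < σ n)
    (hσμ : Tendsto (fun n => σ n / μ n) atTop (𝓝 0)) {t : ℝ} (ht : 0 < t) :
    Tendsto (fun n => (⌊t * μ n / σ n⌋₊ : ℝ) * (σ n / μ n)) atTop (𝓝 t) := by
  have hlow : Tendsto (fun n => t - σ n / μ n) atTop (𝓝 t) := by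
    simpa using tendsto_const_nhds.sub hσμ
  refine tendsto_of_tendsto_of_tendsto_of_le_of_le hlow tendsto_const_nhds (fun n => ?_)
    (fun n => ?_)
  · have hm := hμpos n
    have hs := hσpos n
    have h := (Nat.lt_floor_add_one (t * μ n / σ n)).le
    have e : t = t * μ n / σ n * (σ n / μ n) := by field_simp
    calc t - σ n / μ n = (t * μ n / σ n - 1) * (σ n / μ n) := by rw [sub_mul, ← e, one_mul]
      _ ≤ _ := by gcongr; linarith
  · have hm := hμpos n
    have hs := hσpos n
    have e : t = t * μ n / σ n * (σ n / μ n) := by field_simp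
    calc _ ≤ t * μ n / σ n * (σ n / μ n) := by
          gcongr
          exact Nat.floor_le (by positivity)
      _ = t := e.symm

lemma eventually_abs_log_normFF_sub_le (hμpos : ∀ n, 0 < μ n) (hσpos : ∀ n, 0 < σ n)
    (hσ : Tendsto σ atTop atTop) (hσμ : Tendsto (fun n => σ n / μ n) atTop (𝓝 0))
    (hμσ : Tendsto (fun n => μ n / σ n ^ 3) atTop (𝓝 0)) {t : ℝ} (ht : 0 < t) (A : ℝ)
    {ε : ℝ} (hε : 0 < ε) :
    ∀ᶠ n in atTop, ∀ x : ℕ, |((x : ℝ) - μ n) / σ n| ≤ A →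
      0 < normFF (μ n) ⌊t * μ n / σ n⌋₊ x ∧
        |Real.log (normFF (μ n) ⌊t * μ n / σ n⌋₊ x) - t * (((x : ℝ) - μ n) / σ n)| ≤ ε := by
  have hq := tendsto_floor_mul_div hμpos hσpos hσμ ht
  set q : ℕ → ℝ := fun n => (⌊t * μ n / σ n⌋₊ : ℝ) * (σ n / μ n) with hqdef
  have hk : ∀ n, (⌊t * μ n / σ n⌋₊ : ℝ) = q n * μ n / σ n := fun n => by
    have := (hμpos n).ne'
    have := (hσpos n).ne'
    simp only [hqdef]; field_simp
  have hσi : Tendsto (fun n => (σ n)⁻¹) atTop (𝓝 0) := tendsto_inv_atTop_zero.comp hσ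
  have herr : Tendsto (fun n => 2 * q n * (A ^ 2 * (σ n / μ n) + 2 * A * q n * (σ n)⁻¹
      + q n ^ 2 * (μ n / σ n ^ 3)) + q n * (σ n)⁻¹ / 2 + |q n - t| * A) atTop (𝓝 0) := by
    have h1 := ((((hq.const_mul 2).mul (((hσμ.const_mul (A ^ 2)).add
      ((hq.const_mul (2 * A)).mul hσi)).add ((hq.pow 2).mul hμσ))).add
      ((hq.mul hσi).div_const 2)).add ((hq.sub_const t).abs.mul_const A))
    simpa using h1
  have hDk : Tendsto (fun n => A * (σ n / μ n) + q n * (σ n)⁻¹) atTop (𝓝 0) := by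
    simpa using (hσμ.const_mul A).add (hq.mul hσi)
  filter_upwards [herr.eventually (ge_mem_nhds hε),
    hDk.eventually (ge_mem_nhds (show (0 : ℝ) < 1 / 2 by norm_num))] with n hn hn2 x hx
  have hm := hμpos n
  have hs := hσpos n
  have hxD : |(x : ℝ) - μ n| ≤ A * σ n := by
    rwa [abs_div, abs_of_pos hs, div_le_iff₀ hs] at hx
  have hDk' : A * σ n + (⌊t * μ n / σ n⌋₊ : ℝ) ≤ μ n / 2 := by
    have : A * σ n + (⌊t * μ n / σ n⌋₊ : ℝ)
        = (A * (σ n / μ n) + q n * (σ n)⁻¹) * μ n := by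
      rw [hk n]; field_simp
    rw [this]
    nlinarith
  obtain ⟨h1, h2⟩ := abs_log_normFF_sub_le hm hxD hDk'
  refine ⟨h1, le_trans ?_ hn⟩
  have e1 : (⌊t * μ n / σ n⌋₊ : ℝ) * (((x : ℝ) - μ n) / μ n) = q n * (((x : ℝ) - μ n) / σ n) := by
    simp only [hqdef]; field_simp
  have e2 : (⌊t * μ n / σ n⌋₊ : ℝ) * (2 * ((A * σ n + ⌊t * μ n / σ n⌋₊) / μ n) ^ 2)
      + ⌊t * μ n / σ n⌋₊ / (2 * μ n)
      = 2 * q n * (A ^ 2 * (σ n / μ n) + 2 * A * q n * (σ n)⁻¹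
      + q n ^ 2 * (μ n / σ n ^ 3)) + q n * (σ n)⁻¹ / 2 := by
    rw [hk n]; field_simp; ring
  rw [e1, e2] at h2
  refine (abs_sub_le _ (q n * (((x : ℝ) - μ n) / σ n)) _).trans (add_le_add h2 ?_)
  rw [← sub_mul, abs_mul]
  gcongr

lemma le_mul_of_abs_log_sub_le {a b z r t ε : ℝ} (ha : 0 < a) (hb : 0 < b)
    (hae : |Real.log a - r * z| ≤ 1) (hbe : |Real.log b - t * z| ≤ 1) (hε : 0 < ε)
    (h : (t - r) * z + 2 ≤ Real.log ε) : b ≤ ε * a := by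
  rw [← Real.log_le_log_iff hb (by positivity), Real.log_mul hε.ne' ha.ne']
  have h1 := abs_le.1 hae
  have h2 := abs_le.1 hbe
  linarith [h1.1, h2.2]

lemma floor_mul_div_mono (hμpos : ∀ n, 0 < μ n) (hσpos : ∀ n, 0 < σ n) {r t : ℝ} (hrt : r ≤ t)
    (n : ℕ) : ⌊r * μ n / σ n⌋₊ ≤ ⌊t * μ n / σ n⌋₊ := by
  have hm := hμpos n
  have hs := hσpos n
  gcongr

lemma eventually_normFF_upper_tail (hμpos : ∀ n, 0 < μ n) (hσpos : ∀ n, 0 < σ n)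
    (hσ : Tendsto σ atTop atTop) (hσμ : Tendsto (fun n => σ n / μ n) atTop (𝓝 0))
    (hμσ : Tendsto (fun n => μ n / σ n ^ 3) atTop (𝓝 0)) {t u : ℝ} (ht : 0 < t) (htu : t < u)
    {ε : ℝ} (hε : 0 < ε) :
    ∀ᶠ A : ℝ in atTop, ∀ᶠ n in atTop, ∀ x : ℕ, A < ((x : ℝ) - μ n) / σ n →
      normFF (μ n) ⌊t * μ n / σ n⌋₊ x ≤ ε * normFF (μ n) ⌊u * μ n / σ n⌋₊ x := by
  filter_upwards [eventually_ge_atTop 1,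
    eventually_ge_atTop (1 + (2 - Real.log ε) / (u - t))] with A hA1 hA2
  filter_upwards [eventually_abs_log_normFF_sub_le hμpos hσpos hσ hσμ hμσ ht A one_pos,
    eventually_abs_log_normFF_sub_le hμpos hσpos hσ hσμ hμσ (ht.trans htu) A one_pos,
    hσ.eventually_ge_atTop 1] with n hn1 hn2 hσ1 x hx
  have hm := hμpos n
  have hs := hσpos n
  set y := ⌊μ n + A * σ n⌋₊ with hy
  have hy1 : (y : ℝ) ≤ μ n + A * σ n := Nat.floor_le (by positivity)
  have hy2 := Nat.lt_floor_add_one (μ n + A * σ n)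
  rw [← hy] at hy2
  have hz1 : ((y : ℝ) - μ n) / σ n ≤ A := by rw [div_le_iff₀ hs]; linarith
  have hz2 : A - 1 ≤ ((y : ℝ) - μ n) / σ n := by rw [le_div_iff₀ hs]; nlinarith
  have hzA : |((y : ℝ) - μ n) / σ n| ≤ A := abs_le.2 ⟨by linarith, hz1⟩
  have hyx : y ≤ x := by
    rw [lt_div_iff₀ hs] at hx
    have : (y : ℝ) ≤ x := by linarith
    exact_mod_cast this
  obtain ⟨ht1, ht2⟩ := hn1 y hzA
  obtain ⟨hu1, hu2⟩ := hn2 y hzA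
  have hut : 0 < u - t := sub_pos.2 htu
  have hA3 : 2 - Real.log ε ≤ (A - 1) * (u - t) := by
    rw [← div_le_iff₀ hut]; linarith
  have hle := le_mul_of_abs_log_sub_le hu1 ht1 hu2 ht2 hε (by nlinarith)
  have hmul := normFF_mul_le hm (floor_mul_div_mono hμpos hσpos htu.le n) hyx
  have hx0 := normFF_nonneg hm ⌊u * μ n / σ n⌋₊ x
  refine le_of_mul_le_mul_left ?_ hu1
  calc _ ≤ _ := hmul
    _ ≤ normFF (μ n) ⌊u * μ n / σ n⌋₊ x * (ε * normFF (μ n) ⌊u * μ n / σ n⌋₊ y) := by gcongr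
    _ = _ := by ring

lemma eventually_normFF_lower_tail (hμpos : ∀ n, 0 < μ n) (hσpos : ∀ n, 0 < σ n)
    (hσ : Tendsto σ atTop atTop) (hσμ : Tendsto (fun n => σ n / μ n) atTop (𝓝 0))
    (hμσ : Tendsto (fun n => μ n / σ n ^ 3) atTop (𝓝 0)) {r t : ℝ} (hr : 0 < r) (hrt : r < t)
    {ε : ℝ} (hε : 0 < ε) :
    ∀ᶠ A : ℝ in atTop, ∀ᶠ n in atTop, ∀ x : ℕ, ((x : ℝ) - μ n) / σ n < -A →
      normFF (μ n) ⌊t * μ n / σ n⌋₊ x ≤ ε * normFF (μ n) ⌊r * μ n / σ n⌋₊ x := by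
  filter_upwards [eventually_ge_atTop 1,
    eventually_ge_atTop (1 + (2 - Real.log ε) / (t - r))] with A hA1 hA2
  have hA0 : 0 < A := by linarith
  filter_upwards [eventually_abs_log_normFF_sub_le hμpos hσpos hσ hσμ hμσ hr A one_pos,
    eventually_abs_log_normFF_sub_le hμpos hσpos hσ hσμ hμσ (hr.trans hrt) A one_pos,
    hσ.eventually_ge_atTop 1, hσμ.eventually (ge_mem_nhds (inv_pos.2 hA0))]
    with n hn1 hn2 hσ1 hσA x hx
  have hm := hμpos n
  have hs := hσpos n
  have hAσ : 0 ≤ μ n - A * σ n := by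
    rw [div_le_iff₀ hm] at hσA
    have : A * σ n ≤ A * (A⁻¹ * μ n) := by gcongr
    rw [mul_inv_cancel_left₀ hA0.ne'] at this
    linarith
  set y := ⌈μ n - A * σ n⌉₊ with hy
  have hy1 : μ n - A * σ n ≤ (y : ℝ) := Nat.le_ceil _
  have hy2 := Nat.ceil_lt_add_one hAσ
  rw [← hy] at hy2
  have hz1 : ((y : ℝ) - μ n) / σ n ≤ -(A - 1) := by rw [div_le_iff₀ hs]; nlinarith
  have hz2 : -A ≤ ((y : ℝ) - μ n) / σ n := by rw [le_div_iff₀ hs]; nlinarith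
  have hzA : |((y : ℝ) - μ n) / σ n| ≤ A := abs_le.2 ⟨hz2, by linarith⟩
  have hxy : x ≤ y := by
    rw [div_lt_iff₀ hs] at hx
    have : (x : ℝ) ≤ y := by linarith
    exact_mod_cast this
  obtain ⟨hr1, hr2⟩ := hn1 y hzA
  obtain ⟨ht1, ht2⟩ := hn2 y hzA
  have htr : 0 < t - r := sub_pos.2 hrt
  have hA3 : 2 - Real.log ε ≤ (A - 1) * (t - r) := by
    rw [← div_le_iff₀ htr]; linarith
  have hle := le_mul_of_abs_log_sub_le hr1 ht1 hr2 ht2 hε (by nlinarith)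
  have hmul := normFF_mul_le hm (floor_mul_div_mono hμpos hσpos hrt.le n) hxy
  have hx0 := normFF_nonneg hm ⌊r * μ n / σ n⌋₊ x
  refine le_of_mul_le_mul_right ?_ hr1
  calc _ ≤ _ := hmul
    _ ≤ ε * normFF (μ n) ⌊r * μ n / σ n⌋₊ y * normFF (μ n) ⌊r * μ n / σ n⌋₊ x := by gcongr
    _ = _ := by ring

end FallingFactorialWeights

section FactorialMoments

variable {Ω : Type*} [MeasurableSpace Ω] {P : Measure Ω}

lemma integrable_comp_of_summable [IsFiniteMeasure P] {X : Ω → ℕ} (hX : Measurable X) {f : ℕ → ℝ}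
    (hf0 : ∀ j, 0 ≤ f j) (hf : Summable fun j => (P {ω | X ω = j}).toReal * f j) :
    Integrable (fun ω => f (X ω)) P := by
  have hmap : Integrable f (P.map X) := by
    refine ⟨(measurable_of_countable f).aestronglyMeasurable, ?_⟩
    rw [hasFiniteIntegral_iff_ofReal (ae_of_all _ hf0), lintegral_countable']
    have h : ∀ j, ENNReal.ofReal (f j) * P.map X {j}
        = ENNReal.ofReal ((P {ω | X ω = j}).toReal * f j) := fun j => by
      rw [Measure.map_apply hX (measurableSet_singleton j), mul_comm,
        ENNReal.ofReal_mul ENNReal.toReal_nonneg, ENNReal.ofReal_toReal (measure_ne_top _ _)]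
      rfl
    simp only [h]
    rw [← ENNReal.ofReal_tsum_of_nonneg (fun j => by have := hf0 j; positivity) hf]
    exact ENNReal.ofReal_lt_top
  exact hmap.comp_measurable hX

lemma integral_comp_eq_tsum [IsFiniteMeasure P] {X : Ω → ℕ} (hX : Measurable X) {f : ℕ → ℝ}
    (hf0 : ∀ j, 0 ≤ f j) (hf : Summable fun j => (P {ω | X ω = j}).toReal * f j) :
    ∫ ω, f (X ω) ∂P = ∑' j, (P {ω | X ω = j}).toReal * f j := by
  have hfm : AEStronglyMeasurable f (P.map X) := (measurable_of_countable f).aestronglyMeasurable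
  have hint : Integrable f (P.map X) :=
    (integrable_map_measure hfm hX.aemeasurable).2 (integrable_comp_of_summable hX hf0 hf)
  rw [← integral_map hX.aemeasurable hfm, integral_countable hint]
  refine tsum_congr fun j => ?_
  rw [Measure.real, Measure.map_apply hX (measurableSet_singleton j), smul_eq_mul]
  rfl

lemma integrable_normFF [IsFiniteMeasure P] {X : Ω → ℕ} (hX : Measurable X) {k : ℕ}
    (hf : Summable fun j : ℕ => (P {ω | X ω = j}).toReal * (j.descFactorial k : ℝ)) (m : ℝ) :
    Integrable (fun ω => normFF m k (X ω)) P :=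
  (integrable_comp_of_summable hX (f := fun j => (j.descFactorial k : ℝ))
    (fun _ => Nat.cast_nonneg _) hf).div_const _

lemma integral_normFF [IsFiniteMeasure P] {X : Ω → ℕ} (hX : Measurable X) {k : ℕ}
    (hf : Summable fun j : ℕ => (P {ω | X ω = j}).toReal * (j.descFactorial k : ℝ))
    {m : ℝ} (hm : 0 < m) (s : ℝ) :
    ∫ ω, normFF m k (X ω) ∂P = factorialMoment P X k /
      (m ^ k * Real.exp ((k : ℝ) ^ 2 / 2 * ((s ^ 2 - m) / m ^ 2)))
        * Real.exp ((k * (s / m)) ^ 2 / 2) := by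
  have h := integral_comp_eq_tsum hX (f := fun j => (j.descFactorial k : ℝ))
    (fun _ => Nat.cast_nonneg _) hf
  have hexp : Real.exp ((k : ℝ) ^ 2 / 2 * ((s ^ 2 - m) / m ^ 2))
      = Real.exp (-((k : ℝ) ^ 2 / (2 * m))) * Real.exp ((k * (s / m)) ^ 2 / 2) := by
    rw [← Real.exp_add]
    congr 1
    field_simp
    ring
  simp only [normFF]
  rw [integral_div, h, hexp, factorialMoment]
  field_simp

end FactorialMoments

section Asymptotics

variable {μ σ : ℕ → ℝ}

lemma tendsto_atTop_of_isLittleO_pow (hσpos : ∀ n, 0 < σ n) (hμ : Tendsto μ atTop atTop)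
    (hμσ : μ =o[atTop] fun n => σ n ^ 3) : Tendsto σ atTop atTop := by
  have h3 : Tendsto (fun n => σ n ^ 3) atTop atTop := by
    refine tendsto_atTop_mono' _ ?_ hμ
    filter_upwards [hμσ.bound one_pos] with n hn
    rw [one_mul, Real.norm_of_nonneg (pow_pos (hσpos n) 3).le] at hn
    exact (le_abs_self _).trans hn
  refine tendsto_atTop.2 fun b => ?_
  filter_upwards [h3.eventually_ge_atTop (|b| ^ 3)] with n hn
  exact (le_abs_self b).trans (le_of_pow_le_pow_left₀ three_ne_zero (hσpos n).le hn)

lemma tendsto_div_of_isLittleO_mul_log_sq (hμpos : ∀ n, 0 < μ n) (hσpos : ∀ n, 0 < σ n)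
    (hσ : Tendsto σ atTop atTop) (hσμ : (fun n => σ n * Real.log (σ n) ^ 2) =o[atTop] μ) :
    Tendsto (fun n => σ n / μ n) atTop (𝓝 0) := by
  refine squeeze_zero' (Eventually.of_forall fun n => (div_pos (hσpos n) (hμpos n)).le) ?_
    hσμ.tendsto_div_nhds_zero
  filter_upwards [(Real.tendsto_log_atTop.comp hσ).eventually_ge_atTop 1] with n hn
  have hm := hμpos n
  have hs := hσpos n
  simp only [Function.comp] at hn
  gcongr
  exact le_mul_of_one_le_right hs.le (one_le_pow₀ hn)

lemma tendsto_integral_normFF {Ω : Type*} [MeasurableSpace Ω] {P : Measure Ω}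
    [IsFiniteMeasure P] {X : ℕ → Ω → ℕ} (hX : ∀ n, Measurable (X n))
    (hfin : ∀ n k : ℕ,
      Summable (fun j : ℕ => (P {ω | X n ω = j}).toReal * (j.descFactorial k : ℝ)))
    (hμpos : ∀ n, 0 < μ n) (hσpos : ∀ n, 0 < σ n)
    (hσμ : Tendsto (fun n => σ n / μ n) atTop (𝓝 0)) {c c' : ℝ} (hc : 0 < c)
    (hasymp : ∀ ε : ℝ, 0 < ε → ∃ N : ℕ, ∀ n : ℕ, N ≤ n → ∀ k : ℕ,
      c * μ n / σ n ≤ (k : ℝ) → (k : ℝ) ≤ c' * μ n / σ n →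
      |factorialMoment P (X n) k /
          (μ n ^ k * Real.exp ((k : ℝ) ^ 2 / 2 * ((σ n ^ 2 - μ n) / μ n ^ 2))) - 1| ≤ ε)
    {t : ℝ} (ht : t ∈ Set.Ioo c c') :
    Tendsto (fun n => ∫ ω, normFF (μ n) ⌊t * μ n / σ n⌋₊ (X n ω) ∂P) atTop
      (𝓝 (Real.exp (t ^ 2 / 2))) := by
  have hq := tendsto_floor_mul_div hμpos hσpos hσμ (hc.trans ht.1)
  have hrange : ∀ᶠ n in atTop, c * μ n / σ n ≤ (⌊t * μ n / σ n⌋₊ : ℝ) ∧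
      (⌊t * μ n / σ n⌋₊ : ℝ) ≤ c' * μ n / σ n := by
    filter_upwards [hq.eventually (Ioo_mem_nhds ht.1 ht.2)] with n hn
    have hm := hμpos n
    have hs := hσpos n
    have e : ∀ a : ℝ, a * μ n / σ n * (σ n / μ n) = a := fun a => by field_simp
    have hsm : 0 < σ n / μ n := by positivity
    constructor <;> refine le_of_mul_le_mul_right ?_ hsm <;> rw [e]
    exacts [hn.1.le, hn.2.le]
  have hone : Tendsto (fun n => factorialMoment P (X n) ⌊t * μ n / σ n⌋₊ /
      (μ n ^ ⌊t * μ n / σ n⌋₊ * Real.exp ((⌊t * μ n / σ n⌋₊ : ℝ) ^ 2 / 2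
        * ((σ n ^ 2 - μ n) / μ n ^ 2)))) atTop (𝓝 1) := by
    refine Metric.tendsto_nhds.2 fun ε hε => ?_
    obtain ⟨N, hN⟩ := hasymp (ε / 2) (by positivity)
    filter_upwards [hrange, eventually_ge_atTop N] with n hn hNn
    rw [Real.dist_eq]
    exact (hN n hNn _ hn.1 hn.2).trans_lt (by linarith)
  have hexp := (Real.continuous_exp.tendsto _).comp ((hq.pow 2).div_const 2)
  have := hone.mul hexp
  rw [one_mul] at this
  refine this.congr fun n => ?_
  rw [integral_normFF (hX n) (hfin n _) (hμpos n) (σ n)]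
  rfl

end Asymptotics

end

/-- **Gao–Wormald theorem.** Suppose `μ_n → ∞`, `σ_n log² σ_n = o(μ_n)` and `μ_n = o(σ_n³)`,
and the nonnegative-integer-valued random variables `X_n` (with all factorial moments finite)
satisfy `E[(X_n)_k] ~ μ_n^k exp((k²/2)(σ_n² − μ_n)/μ_n²)` uniformly for integers `k` with
`c μ_n/σ_n ≤ k ≤ c' μ_n/σ_n`.  Then `(X_n − μ_n)/σ_n` converges in distribution to the
standard normal law, i.e. the integrals of every bounded continuous test function converge
to its integral against the standard Gaussian measure. -/
theorem gao_wormald_normality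
    {Ω : Type*} [MeasurableSpace Ω] (P : Measure Ω) [IsProbabilityMeasure P]
    (X : ℕ → Ω → ℕ) (hX : ∀ n, Measurable (X n))
    (hfin : ∀ n k : ℕ,
      Summable (fun j : ℕ => (P {ω | X n ω = j}).toReal * (j.descFactorial k : ℝ)))
    (μ σ : ℕ → ℝ) (hμpos : ∀ n, 0 < μ n) (hσpos : ∀ n, 0 < σ n)
    (hμ : Tendsto μ atTop atTop)
    (hσμ : (fun n => σ n * Real.log (σ n) ^ 2) =o[atTop] μ)
    (hμσ : μ =o[atTop] fun n => σ n ^ 3)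
    (c c' : ℝ) (hc : 0 < c) (hcc' : c < c')
    (hasymp : ∀ ε : ℝ, 0 < ε → ∃ N : ℕ, ∀ n : ℕ, N ≤ n → ∀ k : ℕ,
      c * μ n / σ n ≤ (k : ℝ) → (k : ℝ) ≤ c' * μ n / σ n →
      |factorialMoment P (X n) k /
          (μ n ^ k * Real.exp ((k : ℝ) ^ 2 / 2 * ((σ n ^ 2 - μ n) / μ n ^ 2))) - 1| ≤ ε) :
    ∀ φ : BoundedContinuousFunction ℝ ℝ,
      Tendsto (fun n => ∫ ω, φ (((X n ω : ℝ) - μ n) / σ n) ∂P) atTop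
        (nhds (∫ x, φ x ∂(ProbabilityTheory.gaussianReal 0 1))) := by
  have hμσ' : Tendsto (fun n => μ n / σ n ^ 3) atTop (nhds 0) := hμσ.tendsto_div_nhds_zero
  have hσ : Tendsto σ atTop atTop := tendsto_atTop_of_isLittleO_pow hσpos hμ hμσ
  have hσμ' : Tendsto (fun n => σ n / μ n) atTop (nhds 0) :=
    tendsto_div_of_isLittleO_mul_log_sq hμpos hσpos hσ hσμ
  intro φ
  refine tendsto_integral_of_tendsto_weights (Z := fun n ω => ((X n ω : ℝ) - μ n) / σ n)
    (F := fun t n ω => normFF (μ n) ⌊t * μ n / σ n⌋₊ (X n ω)) ?_ ?_ ?_ ?_ hcc' ?_ ?_ ?_ ?_ φ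
  · exact fun n => (((measurable_of_countable (fun j : ℕ => (j : ℝ))).comp (hX n)).sub_const
      _).div_const _
  · exact fun t n => (measurable_of_countable (normFF (μ n) ⌊t * μ n / σ n⌋₊)).comp (hX n)
  · exact fun t n ω => normFF_nonneg (hμpos n) _ _
  · exact fun t n => integrable_normFF (hX n) (hfin n _) _
  · exact fun t _ => ProbabilityTheory.integrable_exp_mul_gaussianReal t
  · intro t ht
    simpa [ProbabilityTheory.mgf_id_gaussianReal] using
      tendsto_integral_normFF hX hfin hμpos hσpos hσμ' hc hasymp ht
  · intro t ht A ε hε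
    have hδ : 0 < min 1 (ε / 2) := by positivity
    filter_upwards [eventually_abs_log_normFF_sub_le hμpos hσpos hσ hσμ' hμσ' (hc.trans ht.1) A hδ]
      with n hn ω hω
    obtain ⟨h1, h2⟩ := hn (X n ω) hω
    have h3 := Real.abs_exp_sub_one_le (h2.trans (min_le_left _ _))
    rw [Real.exp_sub, Real.exp_log h1] at h3
    rw [Real.exp_neg, ← div_eq_mul_inv]
    linarith [h2.trans (min_le_right _ _)]
  · intro r hr u hu t ht ε hε
    have hr0 := hc.trans hr.1
    filter_upwards [eventually_normFF_upper_tail hμpos hσpos hσ hσμ' hμσ' (hr0.trans ht.1) ht.2 hε,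
      eventually_normFF_lower_tail hμpos hσpos hσ hσμ' hμσ' hr0 ht.1 hε] with A hA1 hA2
    filter_upwards [hA1, hA2] with n hn1 hn2 ω hω
    have hrn := mul_nonneg hε.le (normFF_nonneg (hμpos n) ⌊r * μ n / σ n⌋₊ (X n ω))
    have hun := mul_nonneg hε.le (normFF_nonneg (hμpos n) ⌊u * μ n / σ n⌋₊ (X n ω))
    rw [mul_add]
    rcases lt_abs.1 hω with h | h
    · linarith [hn1 _ h]
    · linarith [hn2 _ (lt_neg_of_lt_neg h)]
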